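/- Let A be a finite abelian group and V a faithful 𝔽_p A-module. For any two subgroups H, K ≤ A one has j_{HK}(V)·j_{H∩K}(V) ≥ j_H(V)·j_K(V), with equality if and only if C_V(H ∩ K) = C_V(H) + C_V(K). -/

import Mathlib

open Polynomial

section Defs

variable (p : ℕ) {G V : Type*} [Group G] [AddCommGroup V] [Module (ZMod p) V]

/-- The fixed-point subspace `C_V(H)` of a subgroup `H ≤ G`. -/
def fixedPts (ρ : Representation (ZMod p) G V) (H : Subgroup G) :
    Submodule (ZMod p) V where
  carrier := {v | ∀ h ∈ H, ρ h v = v}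
  add_mem' := by
    intro a b ha hb h hh
    simp [map_add, ha h hh, hb h hh]
  zero_mem' := by
    intro h hh
    simp
  smul_mem' := by
    intro c v hv h hh
    simp [map_smul, hv h hh]

/-- `E` is an elementary abelian `p`-subgroup. -/
def IsElemAbelian (E : Subgroup G) : Prop :=
  (∀ x ∈ E, x ^ p = 1) ∧ ∀ x ∈ E, ∀ y ∈ E, x * y = y * x

/-- `E` is an offender of `G` on `V`. -/
def IsOffender (ρ : Representation (ZMod p) G V) (E : Subgroup G) : Prop :=
  E ≠ ⊥ ∧ IsElemAbelian p E ∧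
    Nat.card V ≤ Nat.card E * Nat.card (fixedPts p ρ E)

/-- `j_H(V) = |H|·|C_V(H)|/|V|`. -/
noncomputable def jval (ρ : Representation (ZMod p) G V) (H : Subgroup G) : ℚ :=
  ((Nat.card H : ℚ) * (Nat.card (fixedPts p ρ H) : ℚ)) / (Nat.card V : ℚ)

/-- A non-identity element `g` is quadratic on `V`: `(g-1)² = 0` on `V`. -/
def IsQuadElt (ρ : Representation (ZMod p) G V) (g : G) : Prop :=
  g ≠ 1 ∧ (ρ g - 1) ^ 2 = 0

/-- `[V,E,E] = 0`. -/
def IsQuadSubgroup (ρ : Representation (ZMod p) G V) (E : Subgroup G) : Prop :=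
  ∀ e ∈ E, ∀ f ∈ E, (ρ e - 1) * (ρ f - 1) = 0

/-- The set `𝒫(G,V)` of best offenders. -/
def bestOffenders (ρ : Representation (ZMod p) G V) : Set (Subgroup G) :=
  {E | E ≠ ⊥ ∧ IsElemAbelian p E ∧
    ∀ F : Subgroup G, F ≤ E → jval p ρ F ≤ jval p ρ E}

end Defs

/-- The product formula `|HK|·|H ∩ K| = |H|·|K|`. -/
@[to_additive AddSubgroup.card_sup_mul_card_inf]
theorem Subgroup.card_sup_mul_card_inf {G : Type*} [Group G] (H K : Subgroup G) [K.Normal] :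
    Nat.card ↥(H ⊔ K) * Nat.card ↥(H ⊓ K) = Nat.card H * Nat.card K := by
  have hsup := relIndex_mul_relIndex ⊥ K (H ⊔ K) bot_le le_sup_right
  have hinf := relIndex_mul_relIndex ⊥ (H ⊓ K) H bot_le inf_le_left
  rw [relIndex_bot_left, relIndex_bot_left, relIndex_sup_right] at hsup
  rw [relIndex_bot_left, relIndex_bot_left, inf_relIndex_left] at hinf
  rw [← hsup, ← hinf]
  ac_rfl

theorem Submodule.card_sup_mul_card_inf {R M : Type*} [Ring R] [AddCommGroup M] [Module R M]
    (S T : Submodule R M) :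
    Nat.card ↥(S ⊔ T) * Nat.card ↥(S ⊓ T) = Nat.card S * Nat.card T := by
  have h := AddSubgroup.card_sup_mul_card_inf S.toAddSubgroup T.toAddSubgroup
  rw [← Submodule.sup_toAddSubgroup] at h
  exact h

section FixedPoints

variable {p : ℕ} {G V : Type*} [Group G] [AddCommGroup V] [Module (ZMod p) V]
  (ρ : Representation (ZMod p) G V)

theorem fixedPts_antitone : Antitone (fixedPts p ρ) :=
  fun _ _ hHK _ hv h hh => hv h (hHK hh)

theorem fixedPts_sup (H K : Subgroup G) :
    fixedPts p ρ (H ⊔ K) = fixedPts p ρ H ⊓ fixedPts p ρ K := by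
  refine le_antisymm
    (le_inf (fixedPts_antitone ρ le_sup_left) (fixedPts_antitone ρ le_sup_right)) ?_
  rintro v ⟨hH, hK⟩ g hg
  rw [Subgroup.sup_eq_closure] at hg
  induction hg using Subgroup.closure_induction with
  | mem x hx => exact hx.elim (hH x) (hK x)
  | one => simp
  | mul x y _ _ hx hy => simp [hx, hy]
  | inv x _ hx => rw [← hx, ← Module.End.mul_apply, ← map_mul]; simp [hx]

theorem fixedPts_sup_le (H K : Subgroup G) :
    fixedPts p ρ H ⊔ fixedPts p ρ K ≤ fixedPts p ρ (H ⊓ K) :=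
  sup_le (fixedPts_antitone ρ inf_le_left) (fixedPts_antitone ρ inf_le_right)

end FixedPoints

/-- **Lemma (Meierfrankenfeld–Stellmacher).** Let `A` be a finite abelian group and `V` a
faithful `𝔽_p A`-module.  For subgroups `H, K ≤ A` one has
`j_{HK}(V)·j_{H∩K}(V) ≥ j_H(V)·j_K(V)`, with equality if and only if
`C_V(H ∩ K) = C_V(H) + C_V(K)`.  (Since `A` is abelian, `HK = H ⊔ K`.) -/
theorem stmt7 {p : ℕ} (hp : p.Prime) {A V : Type*} [CommGroup A] [Finite A]
    [AddCommGroup V] [Module (ZMod p) V] [Finite V]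
    (ρ : Representation (ZMod p) A V)
    (hfaithful : Function.Injective ρ)
    (H K : Subgroup A) :
    jval p ρ H * jval p ρ K ≤ jval p ρ (H ⊔ K) * jval p ρ (H ⊓ K) ∧
      (jval p ρ (H ⊔ K) * jval p ρ (H ⊓ K) = jval p ρ H * jval p ρ K ↔
        fixedPts p ρ (H ⊓ K) = fixedPts p ρ H ⊔ fixedPts p ρ K) := by
  have hA : (Nat.card ↥(H ⊔ K) * Nat.card ↥(H ⊓ K) : ℚ) = Nat.card H * Nat.card K :=
    mod_cast H.card_sup_mul_card_inf K
  have hV : (Nat.card ↥(fixedPts p ρ H ⊔ fixedPts p ρ K) * Nat.card (fixedPts p ρ (H ⊔ K)) : ℚ) =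
      Nat.card (fixedPts p ρ H) * Nat.card (fixedPts p ρ K) := by
    rw [fixedPts_sup]
    exact_mod_cast (fixedPts p ρ H).card_sup_mul_card_inf (fixedPts p ρ K)
  set c : ℚ := Nat.card H * Nat.card K * Nat.card (fixedPts p ρ (H ⊔ K)) / Nat.card V ^ 2 with hc
  have hcpos : 0 < c := by
    have := Nat.card_pos (α := H)
    have := Nat.card_pos (α := K)
    have := Nat.card_pos (α := fixedPts p ρ (H ⊔ K))
    have := Nat.card_pos (α := V)
    positivity
  have hleft : jval p ρ H * jval p ρ K =
      c * Nat.card ↥(fixedPts p ρ H ⊔ fixedPts p ρ K) := by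
    calc jval p ρ H * jval p ρ K = Nat.card H * Nat.card K *
          (Nat.card (fixedPts p ρ H) * Nat.card (fixedPts p ρ K)) / Nat.card V ^ 2 := by
          simp only [jval]; ring
      _ = _ := by rw [← hV, hc]; ring
  have hright : jval p ρ (H ⊔ K) * jval p ρ (H ⊓ K) =
      c * Nat.card (fixedPts p ρ (H ⊓ K)) := by
    rw [hc, ← hA]
    simp only [jval]
    ring
  have hle := fixedPts_sup_le ρ H K
  rw [hleft, hright, mul_right_inj' hcpos.ne', Nat.cast_inj]
  refine ⟨mul_le_mul_of_nonneg_left ?_ hcpos.le, fun h => ?_, fun h => by rw [h]⟩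
  · exact_mod_cast Nat.card_mono (Set.toFinite _) hle
  · exact SetLike.coe_injective (Set.eq_of_subset_of_ncard_le hle h.le).symm
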